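/- Let D = (V+r, E) be a rooted digraph and m = max_{v ∈ V} λ_D(r,v) ≥ 1. Then there exist pairwise edge-disjoint branchings B₁, B₂, …, B_m in D such that, with D_i = (V+r, B₁ ∪ B₂ ∪ … ∪ B_i), the equalities λ_{D_i}(r,v) = ϱ_{D_i}(v) = min{λ_D(r,v), i} hold for every v ∈ V and every i = 1, 2, …, m. -/

import Mathlib

/- Common setup: a rooted digraph `D = (V+r, E)` is modelled as a finite
vertex type `α` (whose elements are `V ∪ {r}`), a finite edge type `E`
(allowing parallel edges, i.e. a multigraph) and maps `tail head : E → α`.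
Subgraphs / edge subsets are sets `F : Set E`; the whole digraph `D`
corresponds to the edge set `Set.univ`.  "`v ∈ V`" is rendered as `v ≠ r`,
and a vertex subset `X ⊆ V` as `X : Set α` with `r ∉ X`. -/

/-- In-degree of the vertex `v` in the digraph with edge set `F`. -/
noncomputable def inDeg {α E : Type*} (head : E → α) (F : Set E) (v : α) : ℕ :=
  {e ∈ F | head e = v}.ncard

/-- `ϱ_F(X)`: the number of edges of `F` entering the vertex set `X`
(tail outside `X`, head in `X`). -/
noncomputable def rho {α E : Type*} (tail head : E → α) (F : Set E) (X : Set α) : ℕ :=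
  {e ∈ F | tail e ∉ X ∧ head e ∈ X}.ncard

/-- `p` is a directed path from `r` to `v` using edges of `F`:
a nonempty list of consecutive edges, starting at `r`, ending at `v`, and
visiting pairwise distinct vertices. -/
def IsRVPath {α E : Type*} (tail head : E → α) (F : Set E) (r v : α) (p : List E) : Prop :=
  (∀ e ∈ p, e ∈ F) ∧
  List.Chain' (fun e f => head e = tail f) p ∧
  (p.map tail).Nodup ∧ (∀ e ∈ p, tail e ≠ v) ∧
  (∃ e, p.head? = some e ∧ tail e = r) ∧
  (∃ e, p.getLast? = some e ∧ head e = v)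

/-- There exist `n` pairwise edge-disjoint directed paths from `r` to `v`
in the edge set `F`. -/
def HasEDPaths {α E : Type*} (tail head : E → α) (F : Set E) (r v : α) (n : ℕ) : Prop :=
  ∃ P : Fin n → List E, (∀ i, IsRVPath tail head F r v (P i)) ∧
    ∀ i j, i ≠ j → ∀ e, e ∈ P i → e ∉ P j

/-- `λ_F(r,v)`: the local edge-connectivity from `r` to `v`, i.e. the maximum
number of pairwise edge-disjoint directed paths from `r` to `v` in `F`. -/
noncomputable def lam {α E : Type*} (tail head : E → α) (F : Set E) (r v : α) : ℕ :=
  sSup {n | HasEDPaths tail head F r v n}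

/-- `X` is a `v`-tight vertex set in the digraph with edge set `F` and root `r`:
`X ⊆ V` (i.e. `r ∉ X`), `v ∈ X` and `ϱ_F(X) = λ_F(r,v)`. -/
def Tight {α E : Type*} (tail head : E → α) (F : Set E) (r v : α) (X : Set α) : Prop :=
  v ∈ X ∧ r ∉ X ∧ rho tail head F X = lam tail head F r v

/-- The digraph with edge set `F` is a flame with root `r`:
`λ_F(r,v) = ϱ_F(v)` for every `v ∈ V`. -/
def IsFlame {α E : Type*} (tail head : E → α) (F : Set E) (r : α) : Prop :=
  ∀ v, v ≠ r → lam tail head F r v = inDeg head F v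

/-- `F` is a maximal flame within the ambient edge set `A`:
`λ_A(r,v) = λ_F(r,v) = ϱ_F(v)` for every `v ∈ V`. -/
def IsMaxFlameIn {α E : Type*} (tail head : E → α) (A : Set E) (r : α) (F : Set E) : Prop :=
  F ⊆ A ∧ ∀ v, v ≠ r →
    lam tail head A r v = lam tail head F r v ∧
    lam tail head F r v = inDeg head F v

/-- A closed directed walk in `F` with pairwise distinct edges.  (If every
vertex is entered by at most one edge of `F`, the existence of such a walk is
equivalent to the existence of an undirected cycle in `F`.) -/
def IsDicycle {α E : Type*} (tail head : E → α) (F : Set E) (p : List E) : Prop :=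
  p.Nodup ∧ (∀ e ∈ p, e ∈ F) ∧
  List.Chain' (fun e f => head e = tail f) p ∧
  (∃ e f, p.head? = some e ∧ p.getLast? = some f ∧ head f = tail e)

/-- `B` is a branching: every vertex is entered by at most one edge of `B` and,
disregarding edge directions, `B` contains no cycle (under the in-degree
condition this is equivalent to containing no directed cycle). -/
def IsBranching {α E : Type*} (tail head : E → α) (B : Set E) : Prop :=
  (∀ v, inDeg head B v ≤ 1) ∧ ∀ p : List E, ¬ IsDicycle tail head B p

/-- The head-set of an edge set `B`: the vertices entered by an edge of `B`. -/
def headSet {α E : Type*} (head : E → α) (B : Set E) : Set α := {v | ∃ e ∈ B, head e = v}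

/-- Independence in the gammoid `G_D(v)` (with `D` the whole digraph, edge set
`Set.univ`): `X ⊆ in_D(v)` is independent if there are `|X|` pairwise
edge-disjoint directed paths from `r` to `v` in `D` whose set of last edges is
exactly `X`. -/
def GammoidIndep {α E : Type*} (tail head : E → α) (r v : α) (X : Set E) : Prop :=
  ∃ P : Fin X.ncard → List E,
    (∀ i, IsRVPath tail head Set.univ r v (P i)) ∧
    (∀ i j, i ≠ j → ∀ e, e ∈ P i → e ∉ P j) ∧
    (∀ e, e ∈ X ↔ ∃ i, (P i).getLast? = some e)

section RootedDigraph

variable {α E : Type*} {tail head : E → α}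

theorem rho_mono [Finite E] {F G : Set E} (h : F ⊆ G) (X : Set α) :
    rho tail head F X ≤ rho tail head G X :=
  Set.ncard_le_ncard (fun _ he => ⟨h he.1, he.2⟩) (Set.toFinite _)

theorem rho_singleton_le_inDeg [Finite E] (F : Set E) (v : α) :
    rho tail head F {v} ≤ inDeg head F v :=
  Set.ncard_le_ncard (fun _ he => ⟨he.1, he.2.2⟩) (Set.toFinite _)

/-- Deleting edges whose heads lie outside `X` does not change `ϱ(X)`. -/
theorem rho_diff_eq {F B : Set E} {X : Set α} (h : ∀ e ∈ B, head e ∉ X) :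
    rho tail head (F \ B) X = rho tail head F X := by
  unfold rho
  congr 1
  ext e
  constructor
  · rintro ⟨he, h'⟩
    exact ⟨he.1, h'⟩
  · rintro ⟨he, h'⟩
    exact ⟨⟨he, fun hB => h e hB h'.2⟩, h'⟩

/-- If deleting `e` brings `ϱ(X)` below `k`, then `e` enters `X` and `ϱ(X) = k`. -/
theorem enters_of_rho_diff_singleton_lt [Finite E] {F : Set E} {e : E} {X : Set α} {k : ℕ}
    (hlt : rho tail head (F \ {e}) X < k) (hk : k ≤ rho tail head F X) :
    tail e ∉ X ∧ head e ∈ X ∧ rho tail head F X = k := by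
  have hset : {f ∈ F \ {e} | tail f ∉ X ∧ head f ∈ X}
      = {f ∈ F | tail f ∉ X ∧ head f ∈ X} \ {e} := by
    ext f
    simp only [Set.mem_ofPred_eq, Set.mem_sdiff, Set.mem_singleton_iff]
    tauto
  unfold rho at *
  rw [hset] at hlt
  by_cases he : e ∈ {f ∈ F | tail f ∉ X ∧ head f ∈ X}
  · have := Set.ncard_sdiff_singleton_add_one he (Set.toFinite _)
    exact ⟨he.2.1, he.2.2, by omega⟩
  · rw [Set.sdiff_singleton_eq_self he] at hlt
    omega

theorem rho_inter_add_rho_union_le [Finite E] (F : Set E) (X Y : Set α) :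
    rho tail head F (X ∩ Y) + rho tail head F (X ∪ Y)
      ≤ rho tail head F X + rho tail head F Y := by
  unfold rho
  rw [← Set.ncard_union_add_ncard_inter {e ∈ F | tail e ∉ X ∩ Y ∧ head e ∈ X ∩ Y}
      {e ∈ F | tail e ∉ X ∪ Y ∧ head e ∈ X ∪ Y} (Set.toFinite _) (Set.toFinite _),
    ← Set.ncard_union_add_ncard_inter {e ∈ F | tail e ∉ X ∧ head e ∈ X}
      {e ∈ F | tail e ∉ Y ∧ head e ∈ Y} (Set.toFinite _) (Set.toFinite _)]
  apply add_le_add <;> refine Set.ncard_le_ncard (fun e he => ?_) (Set.toFinite _)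
  · simp only [Set.mem_union, Set.mem_inter_iff, Set.mem_ofPred_eq] at he ⊢
    tauto
  · simp only [Set.mem_union, Set.mem_inter_iff, Set.mem_ofPred_eq] at he ⊢
    tauto

/-- A walk starting outside `X` and ending in `X` has an edge entering `X`. -/
theorem exists_entering_edge {X : Set α} (p : List E)
    (hc : p.IsChain fun e f => head e = tail f)
    (hs : ∃ e, p.head? = some e ∧ tail e ∉ X) (ht : ∃ e, p.getLast? = some e ∧ head e ∈ X) :
    ∃ e ∈ p, tail e ∉ X ∧ head e ∈ X := by
  induction p with
  | nil => simp at hs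
  | cons e l ih =>
    have hs' : tail e ∉ X := by simpa using hs
    by_cases he : head e ∈ X
    · exact ⟨e, by simp, hs', he⟩
    · cases l with
      | nil => exact absurd (by simpa using ht) he
      | cons f l =>
        rw [List.isChain_cons_cons] at hc
        obtain ⟨g, hg, hg'⟩ := ih hc.2 ⟨f, by simp, hc.1 ▸ he⟩ (by simpa using ht)
        exact ⟨g, List.mem_cons_of_mem _ hg, hg'⟩

theorem HasEDPaths.le_rho [Finite E] {F : Set E} {r v : α} {n : ℕ} {X : Set α}
    (h : HasEDPaths tail head F r v n) (hv : v ∈ X) (hr : r ∉ X) :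
    n ≤ rho tail head F X := by
  obtain ⟨P, hP, hdis⟩ := h
  have hent : ∀ i, ∃ e ∈ P i, tail e ∉ X ∧ head e ∈ X := by
    intro i
    obtain ⟨-, hc, -, -, ⟨e, he, her⟩, ⟨f, hf, hfv⟩⟩ := hP i
    exact exists_entering_edge _ hc ⟨e, he, her ▸ hr⟩ ⟨f, hf, hfv ▸ hv⟩
  choose g hg hgX using hent
  have hinj : Function.Injective g := by
    intro i j hij
    by_contra hne
    exact hdis i j hne (g i) (hg i) (hij ▸ hg j)
  calc n = (Set.range g).ncard := by
        rw [← Set.image_univ, Set.ncard_image_of_injective _ hinj, Set.ncard_univ, Nat.card_fin]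
    _ ≤ _ := by
        refine Set.ncard_le_ncard ?_ (Set.toFinite _)
        rintro _ ⟨i, rfl⟩
        exact ⟨(hP i).1 _ (hg i), hgX i⟩

theorem hasEDPaths_zero (F : Set E) (r v : α) : HasEDPaths tail head F r v 0 :=
  ⟨Fin.elim0, fun i => i.elim0, fun i => i.elim0⟩

theorem bddAbove_hasEDPaths [Finite E] (F : Set E) {r v : α} (hv : v ≠ r) :
    BddAbove {n | HasEDPaths tail head F r v n} :=
  ⟨_, fun _ hn => hn.le_rho (Set.mem_singleton v) (fun h => hv h.symm)⟩

theorem lam_le_rho [Finite E] {F : Set E} {r v : α} {X : Set α} (hv : v ∈ X) (hr : r ∉ X) :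
    lam tail head F r v ≤ rho tail head F X :=
  csSup_le ⟨0, hasEDPaths_zero F r v⟩ fun _ hn => hn.le_rho hv hr

theorem lam_le_inDeg [Finite E] (F : Set E) {r v : α} (hv : v ≠ r) :
    lam tail head F r v ≤ inDeg head F v :=
  (lam_le_rho (Set.mem_singleton v) (fun h => hv h.symm)).trans (rho_singleton_le_inDeg F v)

/-- Lovász's exchange step: if all relevant cuts have at least `k` edges, and at least `k + 1`
when they avoid `W`, then some edge leaving `W` can be deleted without bringing a cut below `k`. -/
theorem exists_removable_edge [Finite α] [Finite E] {G : Set E} {W : Set α} {k : ℕ}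
    {P : Set α → Prop} (hcompl : P Wᶜ) (hdiff : ∀ X, P X → P (X \ W))
    (hlat : ∀ X Y, P X → P Y → (∃ y ∉ W, y ∈ X ∩ Y) → P (X ∩ Y) ∧ P (X ∪ Y))
    (hlarge : ∀ X, P X → Disjoint X W → k + 1 ≤ rho tail head G X)
    (hcut : ∀ X, P X → k ≤ rho tail head G X) :
    ∃ e ∈ G, tail e ∈ W ∧ head e ∉ W ∧ ∀ X, P X → k ≤ rho tail head (G \ {e}) X := by
  by_cases hcrit : ∃ X, P X ∧ rho tail head G X = k
  · obtain ⟨X, hX⟩ :=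
      (Set.toFinite {X | P X ∧ rho tail head G X = k}).exists_minimal hcrit
    obtain ⟨⟨hPX, hXk⟩, hmin⟩ := hX
    obtain ⟨e, ⟨heG, het, heh⟩, hne⟩ :
        ∃ e ∈ {e ∈ G | tail e ∉ X \ W ∧ head e ∈ X \ W},
          e ∉ {e ∈ G | tail e ∉ X ∧ head e ∈ X} := by
      by_contra! hsub
      have h1 : rho tail head G (X \ W) ≤ rho tail head G X :=
        Set.ncard_le_ncard hsub (Set.toFinite _)
      have h2 := hlarge _ (hdiff X hPX) Set.disjoint_sdiff_left
      omega
    have hetX : tail e ∈ X := by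
      by_contra h
      exact hne ⟨heG, h, heh.1⟩
    have hetW : tail e ∈ W := by
      by_contra h
      exact het ⟨hetX, h⟩
    refine ⟨e, heG, hetW, heh.2, fun Z hZ => ?_⟩
    by_contra! hlt
    obtain ⟨htZ, hhZ, hZk⟩ := enters_of_rho_diff_singleton_lt hlt (hcut Z hZ)
    obtain ⟨hi, hu⟩ := hlat X Z hPX hZ ⟨head e, heh.2, heh.1, hhZ⟩
    have h1 := rho_inter_add_rho_union_le (tail := tail) (head := head) G X Z
    have h2 := hcut _ hi
    have h3 := hcut _ hu
    have h4 : X ≤ X ∩ Z := hmin ⟨hi, by omega⟩ Set.inter_subset_left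
    exact htZ (h4 hetX).2
  · have h1 := hlarge _ hcompl disjoint_compl_left
    obtain ⟨e, heG, het, heh⟩ : {e ∈ G | tail e ∉ Wᶜ ∧ head e ∈ Wᶜ}.Nonempty := by
      apply Set.nonempty_of_ncard_ne_zero
      unfold rho at h1
      omega
    refine ⟨e, heG, not_not.1 het, heh, fun Z hZ => ?_⟩
    by_contra! hlt
    exact hcrit ⟨Z, hZ, (enters_of_rho_diff_singleton_lt hlt (hcut Z hZ)).2.2⟩

theorem IsRVPath.mono {F G : Set E} (h : F ⊆ G) {r v : α} {p : List E}
    (hp : IsRVPath tail head F r v p) : IsRVPath tail head G r v p :=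
  ⟨fun e he => h (hp.1 e he), hp.2⟩

theorem isRVPath_singleton {F : Set E} {e : E} (he : e ∈ F) (hne : tail e ≠ head e) :
    IsRVPath tail head F (tail e) (head e) [e] :=
  ⟨by simpa using he, List.isChain_singleton e, by simp, by simpa using hne, ⟨e, by simp⟩,
    ⟨e, by simp⟩⟩

theorem IsRVPath.append_edge {F : Set E} {r : α} {p : List E} {e : E}
    (hp : IsRVPath tail head F r (tail e) p) (he : e ∈ F) (hne : tail e ≠ head e)
    (hnew : ∀ f ∈ p, tail f ≠ head e) : IsRVPath tail head F r (head e) (p ++ [e]) := by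
  obtain ⟨hF, hc, hnd, hnt, ⟨a, ha, har⟩, ⟨b, hb, hbt⟩⟩ := hp
  refine ⟨?_, ?_, ?_, ?_, ⟨a, ?_, har⟩, ⟨e, by simp, rfl⟩⟩
  · simp only [List.mem_append, List.mem_singleton]
    rintro f (hf | rfl)
    exacts [hF f hf, he]
  · refine List.IsChain.append hc (List.isChain_singleton e) ?_
    intro x hx y hy
    obtain rfl : b = x := Option.some_injective _ (hb.symm.trans hx)
    obtain rfl : e = y := Option.some_injective _ hy
    exact hbt
  · rw [List.map_append, List.nodup_append]
    refine ⟨hnd, by simp, ?_⟩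
    intro x hx y hy
    obtain ⟨f, hf, rfl⟩ := List.mem_map.1 hx
    obtain rfl : y = tail e := by simpa using hy
    exact hnt f hf
  · simp only [List.mem_append, List.mem_singleton]
    rintro f (hf | rfl)
    exacts [hnew f hf, hne]
  · simp [ha]

/-- One can delete a path to `v` so that each cut separating `r` from `v` loses at most one edge. -/
theorem exists_path_of_le_rho [Finite α] [Finite E] {F : Set E} {r v : α} (hv : v ≠ r) {k : ℕ}
    (h : ∀ X, v ∈ X → r ∉ X → k + 1 ≤ rho tail head F X) :
    ∃ p, IsRVPath tail head F r v p ∧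
      ∀ X, v ∈ X → r ∉ X → k ≤ rho tail head (F \ {e | e ∈ p}) X := by
  let Inv : Set α → Set E → Prop := fun W B =>
    r ∈ W ∧ B ⊆ F ∧ (∀ e ∈ B, head e ∈ W) ∧
      (∀ X, v ∈ X → r ∉ X → k ≤ rho tail head (F \ B) X) ∧
      ∀ w ∈ W, w ≠ r → ∃ p, IsRVPath tail head B r w p ∧ ∀ e ∈ p, tail e ∈ W
  obtain ⟨W, ⟨B, hrW, hBF, hBW, hcut, hpath⟩, hmax⟩ :=
    (Set.toFinite {W | ∃ B, Inv W B}).exists_maximal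
      ⟨{r}, ∅, rfl, Set.empty_subset _, by simp,
        fun X h1 h2 => by rw [Set.sdiff_empty]; exact (Nat.le_succ k).trans (h X h1 h2),
        fun w hw hwr => absurd hw hwr⟩
  have hvW : v ∈ W := by
    by_contra hvW
    obtain ⟨e, ⟨heF, -⟩, het, heh, hecut⟩ := exists_removable_edge (tail := tail) (head := head)
      (G := F \ B) (W := W) (k := k) (P := fun X => v ∈ X ∧ r ∉ X)
      ⟨hvW, fun h => h hrW⟩ (fun X hX => ⟨⟨hX.1, hvW⟩, fun h => hX.2 h.1⟩)
      (fun X Y hX hY _ => ⟨⟨⟨hX.1, hY.1⟩, fun h => hX.2 h.1⟩,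
        ⟨Or.inl hX.1, fun h => h.elim hX.2 hY.2⟩⟩)
      (fun X hX hXW => by
        rw [rho_diff_eq fun e he hX' => Set.disjoint_left.1 hXW hX' (hBW e he)]
        exact h X hX.1 hX.2)
      (fun X hX => hcut X hX.1 hX.2)
    have hne : tail e ≠ head e := fun h => heh (h ▸ het)
    have hle := hmax (y := insert (head e) W) ⟨insert e B, Or.inr hrW,
      Set.insert_subset heF hBF, ?_, ?_, ?_⟩ (Set.subset_insert _ _)
    · exact heh (hle (Set.mem_insert _ _))
    · rintro f (rfl | hf)
      exacts [Or.inl rfl, Or.inr (hBW f hf)]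
    · intro X h1 h2
      have : F \ insert e B = (F \ B) \ {e} := by
        ext f
        simp only [Set.mem_sdiff, Set.mem_insert_iff, Set.mem_singleton_iff]
        tauto
      rw [this]
      exact hecut X ⟨h1, h2⟩
    · rintro w (rfl | hw) hwr
      · by_cases htr : tail e = r
        · exact ⟨[e], htr ▸ isRVPath_singleton (Set.mem_insert _ _) hne, by simp [het]⟩
        · obtain ⟨p, hp, hpW⟩ := hpath _ het htr
          refine ⟨p ++ [e], (hp.mono (Set.subset_insert _ _)).append_edge
            (Set.mem_insert _ _) hne fun f hf hfe => heh (hfe ▸ hpW f hf), ?_⟩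
          simp only [List.mem_append, List.mem_singleton]
          rintro f (hf | rfl)
          exacts [Or.inr (hpW f hf), Or.inr het]
      · obtain ⟨p, hp, hpW⟩ := hpath w hw hwr
        exact ⟨p, hp.mono (Set.subset_insert _ _), fun f hf => Or.inr (hpW f hf)⟩
  obtain ⟨p, hp, -⟩ := hpath v hvW hv
  refine ⟨p, hp.mono hBF, fun X h1 h2 => (hcut X h1 h2).trans (rho_mono ?_ X)⟩
  exact Set.sdiff_subset_sdiff_right hp.1

/-- Menger's theorem, edge version. -/
theorem hasEDPaths_of_le_rho [Finite α] [Finite E] {r v : α} (hv : v ≠ r) (n : ℕ) (F : Set E)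
    (h : ∀ X, v ∈ X → r ∉ X → n ≤ rho tail head F X) : HasEDPaths tail head F r v n := by
  induction n generalizing F with
  | zero => exact hasEDPaths_zero F r v
  | succ k ih =>
    obtain ⟨p, hp, hcut⟩ := exists_path_of_le_rho hv h
    obtain ⟨P, hP, hdis⟩ := ih _ hcut
    have hPp : ∀ i, ∀ e ∈ P i, e ∉ p := fun i e he => ((hP i).1 e he).2
    refine ⟨Fin.cons p P, fun i => ?_, fun i j hij e => ?_⟩
    · cases i using Fin.cases with
      | zero => exact hp
      | succ i => exact (hP i).mono Set.sdiff_subset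
    · cases i using Fin.cases <;> cases j using Fin.cases
      · exact absurd rfl hij
      · exact fun he he' => hPp _ e he' he
      · exact hPp _ e
      · exact hdis _ _ (fun h => hij (congrArg _ h)) e

theorem le_lam [Finite α] [Finite E] {F : Set E} {r v : α} (hv : v ≠ r) {n : ℕ}
    (h : ∀ X, v ∈ X → r ∉ X → n ≤ rho tail head F X) : n ≤ lam tail head F r v :=
  le_csSup (bddAbove_hasEDPaths F hv) (hasEDPaths_of_le_rho hv n F h)

theorem lam_mono [Finite α] [Finite E] {F G : Set E} (h : F ⊆ G) {r v : α} (hv : v ≠ r) :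
    lam tail head F r v ≤ lam tail head G r v :=
  le_lam hv fun X hX hr => (lam_le_rho hX hr).trans (rho_mono h X)

theorem exists_tight [Finite α] [Finite E] (F : Set E) {r v : α} (hv : v ≠ r) :
    ∃ X, Tight tail head F r v X := by
  by_contra! hno
  have : lam tail head F r v + 1 ≤ lam tail head F r v := le_lam hv fun X hX hr =>
    Nat.lt_of_le_of_ne (lam_le_rho hX hr) fun h => hno X ⟨hX, hr, h.symm⟩
  omega

/-- Lovász's theorem: every rooted digraph has a maximal flame, which moreover can be chosen to
contain no edge entering the root. -/
theorem exists_isMaxFlameIn [Finite α] [Finite E] (tail head : E → α) (r : α) :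
    ∃ F, IsMaxFlameIn tail head Set.univ r F ∧ ∀ e ∈ F, head e ≠ r := by
  obtain ⟨F, hF, hmin⟩ := (Set.toFinite {F : Set E | ∀ v, v ≠ r →
    lam tail head Set.univ r v ≤ lam tail head F r v}).exists_minimal
      ⟨Set.univ, fun _ _ => le_rfl⟩
  have heq : ∀ v, v ≠ r → lam tail head Set.univ r v = lam tail head F r v := fun v hv =>
    (hF v hv).antisymm (lam_mono (Set.subset_univ _) hv)
  have htight : ∀ e ∈ F, ∃ w X, w ≠ r ∧ Tight tail head F r w X ∧ tail e ∉ X ∧ head e ∈ X := by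
    intro e he
    have hnot : F \ {e} ∉ {F : Set E | ∀ v, v ≠ r →
        lam tail head Set.univ r v ≤ lam tail head F r v} := fun hmem =>
      ((hmin hmem Set.sdiff_subset) he).2 rfl
    simp only [Set.mem_ofPred_eq, not_forall, not_le] at hnot
    obtain ⟨w, hw, hlt⟩ := hnot
    rw [heq w hw] at hlt
    obtain ⟨X, hwX, hrX, hX⟩ := exists_tight (tail := tail) (head := head) (F \ {e}) hw
    obtain ⟨h1, h2, h3⟩ := enters_of_rho_diff_singleton_lt (hX ▸ hlt) (lam_le_rho hwX hrX)
    exact ⟨w, X, hw, ⟨hwX, hrX, h3⟩, h1, h2⟩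
  refine ⟨F, ⟨Set.subset_univ _, fun v hv => ⟨heq v hv, ?_⟩⟩, fun e he => ?_⟩
  · refine (lam_le_inDeg F hv).antisymm ?_
    obtain ⟨T, ⟨hvT, hrT, hT⟩, hTmin⟩ :=
      (Set.toFinite {X | Tight tail head F r v X}).exists_minimal (exists_tight F hv)
    rw [← hT]
    refine Set.ncard_le_ncard ?_ (Set.toFinite _)
    rintro e ⟨heF, rfl⟩
    obtain ⟨w, X, hw, ⟨hwX, hrX, hX⟩, htX, hhX⟩ := htight e heF
    have h1 := rho_inter_add_rho_union_le (tail := tail) (head := head) F X T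
    have h2 : lam tail head F r (head e) ≤ rho tail head F (X ∩ T) :=
      lam_le_rho ⟨hhX, hvT⟩ fun h => hrX h.1
    have h3 : lam tail head F r w ≤ rho tail head F (X ∪ T) :=
      lam_le_rho (Or.inl hwX) fun h => h.elim hrX hrT
    have h4 : T ≤ X ∩ T :=
      hTmin ⟨⟨hhX, hvT⟩, fun h => hrX h.1, by omega⟩ Set.inter_subset_right
    exact ⟨heF, fun h => htX (h4 h).1, hvT⟩
  · obtain ⟨w, X, -, hX, -, hh⟩ := htight e he
    exact fun h => hX.2.1 (h ▸ hh)

theorem IsDicycle.exists_next {B : Set E} {p : List E} (hp : IsDicycle tail head B p) {e : E}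
    (he : e ∈ p) : ∃ f ∈ p, tail f = head e := by
  obtain ⟨-, -, hc, a, b, ha, hb, hba⟩ := hp
  obtain ⟨l, l', rfl⟩ := List.append_of_mem he
  cases l' with
  | nil =>
    rw [List.getLast?_append] at hb
    simp only [List.getLast?_singleton, Option.some_or, Option.some.injEq] at hb
    subst hb
    exact ⟨a, List.mem_of_head? ha, hba.symm⟩
  | cons f l' =>
    have := (List.isChain_append.1 hc).2.1
    exact ⟨f, by simp, ((List.isChain_cons_cons.1 this).1).symm⟩

theorem not_isDicycle_insert {B : Set E} (hB : ∀ p, ¬ IsDicycle tail head B p) {e : E}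
    (he : ∀ f ∈ insert e B, tail f ≠ head e) (p : List E) :
    ¬ IsDicycle tail head (insert e B) p := by
  intro hp
  have hep : e ∉ p := fun h => by
    obtain ⟨f, hf, hfe⟩ := hp.exists_next h
    exact he f (hp.2.1 f hf) hfe
  exact hB p ⟨hp.1, fun f hf => (hp.2.1 f hf).resolve_left fun h => hep (h ▸ hf), hp.2.2⟩

/-- If every cut meeting `U` has at least `k + 1` edges, there is an acyclic edge set entering each
vertex of `U` once and no other vertex, of which each cut meeting `U` can spare all edges but
`k`. -/
theorem exists_branching_of_le_rho [Finite α] [Finite E] {F : Set E} {r : α} {U : Set α} {k : ℕ}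
    (hrU : r ∉ U) (h : ∀ X, r ∉ X → (X ∩ U).Nonempty → k + 1 ≤ rho tail head F X) :
    ∃ B ⊆ F, (∀ e ∈ B, head e ∈ U) ∧ (∀ u ∈ U, inDeg head B u = 1) ∧
      (∀ p, ¬ IsDicycle tail head B p) ∧
      ∀ X, r ∉ X → (X ∩ U).Nonempty → k ≤ rho tail head (F \ B) X := by
  let Inv : Set α → Set E → Prop := fun W B =>
    Uᶜ ⊆ W ∧ B ⊆ F ∧ (∀ e ∈ B, head e ∈ U ∧ head e ∈ W ∧ tail e ∈ W) ∧
      (∀ u ∈ U, u ∈ W → inDeg head B u = 1) ∧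
      (∀ p, ¬ IsDicycle tail head B p) ∧
      ∀ X, r ∉ X → (X ∩ U).Nonempty → k ≤ rho tail head (F \ B) X
  obtain ⟨W, ⟨B, hUW, hBF, hBW, hdeg, hacyc, hcut⟩, hmax⟩ :=
    (Set.toFinite {W | ∃ B, Inv W B}).exists_maximal
      ⟨Uᶜ, ∅, le_rfl, Set.empty_subset _, by simp, fun u hu hu' => absurd hu hu', by
        rintro p ⟨-, hp, -, a, -, ha, -⟩
        exact hp a (List.mem_of_head? ha),
        fun X h1 h2 => by rw [Set.sdiff_empty]; exact (Nat.le_succ k).trans (h X h1 h2)⟩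
  have hU : ∀ y ∉ W, y ∈ U := fun y hy => by
    by_contra hyU
    exact hy (hUW hyU)
  have hrW : r ∈ W := hUW hrU
  have hWall : ∀ y, y ∈ W := by
    by_contra! hWne
    obtain ⟨z, hz⟩ := hWne
    obtain ⟨e, ⟨heF, heB⟩, het, heh, hecut⟩ := exists_removable_edge (tail := tail) (head := head)
      (G := F \ B) (W := W) (k := k) (P := fun X => r ∉ X ∧ ∃ y ∉ W, y ∈ X)
      ⟨fun h => h hrW, z, hz, hz⟩
      (fun X ⟨hr, y, hy, hyX⟩ => ⟨fun h => hr h.1, y, hy, hyX, hy⟩)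
      (fun X Y hX hY ⟨y, hy, hyXY⟩ => ⟨⟨fun h => hX.1 h.1, y, hy, hyXY⟩,
        ⟨fun h => h.elim hX.1 hY.1, y, hy, Or.inl hyXY.1⟩⟩)
      (fun X ⟨hr, y, hy, hyX⟩ hXW => by
        rw [rho_diff_eq fun e he hX' => Set.disjoint_left.1 hXW hX' (hBW e he).2.1]
        exact h X hr ⟨y, hyX, hU y hy⟩)
      (fun X ⟨hr, y, hy, hyX⟩ => hcut X hr ⟨y, hyX, hU y hy⟩)
    have hle := hmax (y := insert (head e) W) ⟨insert e B, hUW.trans (Set.subset_insert _ _),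
      Set.insert_subset heF hBF, ?_, ?_, ?_, ?_⟩ (Set.subset_insert _ _)
    · exact heh (hle (Set.mem_insert _ _))
    · rintro f (rfl | hf)
      · exact ⟨hU _ heh, Or.inl rfl, Or.inr het⟩
      · exact ⟨(hBW f hf).1, Or.inr (hBW f hf).2.1, Or.inr (hBW f hf).2.2⟩
    · rintro u hu (rfl | huW)
      · have : {f ∈ insert e B | head f = head e} = {e} := by
          ext f
          simp only [Set.mem_ofPred_eq, Set.mem_insert_iff, Set.mem_singleton_iff]
          constructor
          · rintro ⟨hf | hf, hfe⟩
            · exact hf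
            · exact absurd (hfe ▸ (hBW f hf).2.1) heh
          · rintro rfl
            exact ⟨Or.inl rfl, rfl⟩
        rw [inDeg, this, Set.ncard_singleton]
      · rw [← hdeg u hu huW, inDeg, inDeg]
        congr 1
        ext f
        simp only [Set.mem_ofPred_eq, Set.mem_insert_iff]
        constructor
        · rintro ⟨rfl | hf, hfe⟩
          · exact absurd (hfe ▸ huW) heh
          · exact ⟨hf, hfe⟩
        · rintro ⟨hf, hfe⟩
          exact ⟨Or.inr hf, hfe⟩
    · refine not_isDicycle_insert hacyc ?_
      rintro f (rfl | hf) hfe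
      · exact heh (hfe ▸ het)
      · exact heh (hfe ▸ (hBW f hf).2.2)
    · intro X hr hXU
      have : F \ insert e B = (F \ B) \ {e} := by
        ext f
        simp only [Set.mem_sdiff, Set.mem_insert_iff, Set.mem_singleton_iff]
        tauto
      rw [this]
      by_cases hX : ∃ y ∉ W, y ∈ X
      · exact hecut X ⟨hr, hX⟩
      · rw [rho_diff_eq]
        · exact hcut X hr hXU
        · rintro f rfl hf
          exact hX ⟨_, heh, hf⟩
  exact ⟨B, hBF, fun e he => (hBW e he).1, fun u hu => hdeg u hu (hWall u), hacyc, hcut⟩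

theorem inDeg_diff_add_inDeg [Finite E] {B F : Set E} (h : B ⊆ F) (v : α) :
    inDeg head (F \ B) v + inDeg head B v = inDeg head F v := by
  have hset : {e ∈ F \ B | head e = v} = {e ∈ F | head e = v} \ {e ∈ B | head e = v} := by
    ext e
    simp only [Set.mem_ofPred_eq, Set.mem_sdiff]
    tauto
  unfold inDeg
  rw [hset]
  exact Set.ncard_sdiff_add_ncard_of_subset (fun e he => ⟨h he.1, he.2⟩) (Set.toFinite _)

theorem inDeg_eq_zero {B : Set E} {v : α} (h : ∀ e ∈ B, head e ≠ v) : inDeg head B v = 0 := by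
  have : {e ∈ B | head e = v} = ∅ := Set.eq_empty_of_forall_notMem fun e he => h e he.1 he.2
  rw [inDeg, this, Set.ncard_empty]

/-- `F` is a flame without edges entering the root whose local edge-connectivities are those of
the whole digraph truncated at `k`. -/
def IsTruncatedFlame (tail head : E → α) (r : α) (k : ℕ) (F : Set E) : Prop :=
  (∀ e ∈ F, head e ≠ r) ∧ ∀ v, v ≠ r →
    lam tail head F r v = inDeg head F v ∧
    inDeg head F v = min (lam tail head Set.univ r v) k

theorem IsTruncatedFlame.exists_pred [Finite α] [Finite E] {r : α} {k : ℕ} {F : Set E}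
    (hF : IsTruncatedFlame tail head r (k + 1) F) :
    ∃ G ⊆ F, IsTruncatedFlame tail head r k G ∧ IsBranching tail head (F \ G) := by
  obtain ⟨hroot, hflame⟩ := hF
  obtain ⟨B, hBF, hBU, hdeg, hacyc, hcut⟩ :=
    exists_branching_of_le_rho (tail := tail) (head := head) (F := F) (r := r) (k := k)
      (U := {v | v ≠ r ∧ inDeg head F v = k + 1}) (fun h => h.1 rfl) (by
        rintro X hr ⟨u, huX, hur, hu⟩
        rw [← hu, ← (hflame u hur).1]
        exact lam_le_rho huX hr)
  have hdeg_out : ∀ v, v ∉ {v | v ≠ r ∧ inDeg head F v = k + 1} → inDeg head B v = 0 :=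
    fun v hv => inDeg_eq_zero fun e he hev => hv (hev ▸ hBU e he)
  refine ⟨F \ B, Set.sdiff_subset, ⟨fun e he => hroot e he.1, fun v hv => ?_⟩, ?_⟩
  · have hsum := inDeg_diff_add_inDeg (head := head) hBF v
    have hmin : inDeg head (F \ B) v = min (lam tail head Set.univ r v) k := by
      have := (hflame v hv).2
      by_cases hvU : inDeg head F v = k + 1
      · have := hdeg v ⟨hv, hvU⟩
        omega
      · have := hdeg_out v fun h => hvU h.2
        omega
    refine ⟨(lam_le_inDeg _ hv).antisymm (le_lam hv fun X hvX hrX => ?_), hmin⟩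
    by_cases hXU : (X ∩ {v | v ≠ r ∧ inDeg head F v = k + 1}).Nonempty
    · exact (hmin.le.trans (min_le_right _ _)).trans (hcut X hrX hXU)
    · rw [rho_diff_eq fun e he heX => hXU ⟨_, heX, hBU e he⟩]
      calc inDeg head (F \ B) v ≤ inDeg head F v := by omega
        _ = lam tail head F r v := (hflame v hv).1.symm
        _ ≤ _ := lam_le_rho hvX hrX
  · rw [Set.sdiff_sdiff_cancel_left hBF]
    refine ⟨fun v => ?_, hacyc⟩
    by_cases hvU : v ∈ {v | v ≠ r ∧ inDeg head F v = k + 1}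
    · exact (hdeg v hvU).le
    · exact (hdeg_out v hvU).trans_le zero_le_one

theorem IsTruncatedFlame.eq_empty [Finite E] {r : α} {F : Set E}
    (hF : IsTruncatedFlame tail head r 0 F) : F = ∅ := by
  refine Set.eq_empty_of_forall_notMem fun e he => ?_
  have h : inDeg head F (head e) = 0 := by simpa using (hF.2 _ (hF.1 e he)).2
  rw [inDeg, Set.ncard_eq_zero (Set.toFinite _)] at h
  exact Set.notMem_empty e (h ▸ ⟨he, rfl⟩)

theorem IsTruncatedFlame.exists_chain [Finite α] [Finite E] {r : α} {k : ℕ} {F : Set E}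
    (hF : IsTruncatedFlame tail head r k F) :
    ∃ D : ℕ → Set E, Monotone D ∧ (∀ i ≤ k, IsTruncatedFlame tail head r i (D i)) ∧
      (∀ i < k, IsBranching tail head (D (i + 1) \ D i)) ∧ ∀ i, k ≤ i → D i = F := by
  induction k generalizing F with
  | zero =>
    refine ⟨fun _ => F, monotone_const, fun i hi => ?_, fun i hi => absurd hi (Nat.not_lt_zero i),
      fun _ _ => rfl⟩
    rwa [Nat.le_zero.1 hi]
  | succ k ih =>
    obtain ⟨G, hGF, hG, hbr⟩ := hF.exists_pred
    obtain ⟨D, hmono, hflame, hD, hDG⟩ := ih hG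
    refine ⟨fun i => if i ≤ k then D i else F, monotone_nat_of_le_succ fun i => ?_,
      fun i hi => ?_, fun i hi => ?_, fun i hi => if_neg (by omega)⟩
    · by_cases h1 : i + 1 ≤ k
      · simpa [h1, (Nat.le_succ i).trans h1] using hmono (Nat.le_succ i)
      · by_cases h2 : i ≤ k
        · have : D i ≤ F := (hmono h2).trans ((hDG k le_rfl).trans_le hGF)
          simpa [h1, h2] using this
        · simp [h1, h2]
    · by_cases h : i ≤ k
      · simpa [h] using hflame i h
      · obtain rfl : i = k + 1 := by omega
        simpa using hF
    · by_cases h : i < k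
      · simpa [h.le, Nat.succ_le_of_lt h] using hD i h
      · obtain rfl : i = k := by omega
        simpa [hDG i le_rfl] using hbr

end RootedDigraph

/-- with `m = max_{v ∈ V} λ_D(r,v) ≥ 1`, there exist pairwise
edge-disjoint branchings `B₁, …, B_m` in `D` (here `B i` for `i : Fin m` plays
the role of `B_{i+1}`) such that, with `D_i = B₁ ∪ … ∪ B_i`,
`λ_{D_i}(r,v) = ϱ_{D_i}(v) = min{λ_D(r,v), i}` holds for every `v ∈ V` and
every `i = 1, …, m`. -/
theorem disjoint_branchings_chain
    {α E : Type*} [Fintype α] [Fintype E] (tail head : E → α) (r : α)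
    (m : ℕ) (hm : 1 ≤ m)
    (hub : ∀ v, v ≠ r → lam tail head Set.univ r v ≤ m)
    (hex : ∃ v, v ≠ r ∧ lam tail head Set.univ r v = m) :
    ∃ B : Fin m → Set E,
      (∀ i, IsBranching tail head (B i)) ∧
      (∀ i j, i ≠ j → Disjoint (B i) (B j)) ∧
      ∀ (i : Fin m) (v : α), v ≠ r →
        lam tail head (⋃ j ∈ Set.Iic i, B j) r v
          = inDeg head (⋃ j ∈ Set.Iic i, B j) v ∧
        inDeg head (⋃ j ∈ Set.Iic i, B j) v
          = min (lam tail head Set.univ r v) ((i : ℕ) + 1) := by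
  obtain ⟨F, ⟨-, hF⟩, hroot⟩ := exists_isMaxFlameIn tail head r
  have hFm : IsTruncatedFlame tail head r m F := ⟨hroot, fun v hv =>
    ⟨(hF v hv).2, by rw [min_eq_left (hub v hv), (hF v hv).1, (hF v hv).2]⟩⟩
  obtain ⟨D, hmono, hflame, hbr, -⟩ := hFm.exists_chain
  have hunion : ∀ i : Fin m, ⋃ j ∈ Set.Iic i, D (j + 1) \ D j = D (i + 1) := by
    intro i
    ext e
    simp only [Set.mem_iUnion, Set.mem_Iic, exists_prop]
    constructor
    · rintro ⟨j, hj, he⟩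
      exact hmono (Nat.succ_le_succ hj) he.1
    · intro he
      classical
      have hex' : ∃ n, e ∈ D n := ⟨_, he⟩
      have h0 : Nat.find hex' ≠ 0 := fun h => by
        have hmem := Nat.find_spec hex'
        rw [h, (hflame 0 (Nat.zero_le m)).eq_empty] at hmem
        exact hmem
      obtain ⟨n, hn⟩ := Nat.exists_eq_succ_of_ne_zero h0
      have hle : n + 1 ≤ i + 1 := hn.symm.trans_le (Nat.find_min' hex' he)
      exact ⟨⟨n, by omega⟩, Fin.mk_le_of_le_val (by omega), hn ▸ Nat.find_spec hex',
        Nat.find_min hex' (by simp [hn])⟩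
  refine ⟨fun i => D (i + 1) \ D i, fun i => hbr i i.2, fun i j hij => ?_, fun i v hv => ?_⟩
  · rcases lt_or_gt_of_ne hij with h | h
    · exact Set.disjoint_left.2 fun e he he' => he'.2 (hmono (Nat.succ_le_of_lt h) he.1)
    · exact Set.disjoint_left.2 fun e he he' => he.2 (hmono (Nat.succ_le_of_lt h) he'.1)
  · rw [hunion i]
    exact (hflame (i + 1) i.2).2 v hv
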